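/- Let X₁,…,Xₙ be i.i.d. from a probability measure P on [0,1]^d with density f bounded by f_max. For any 0 < δ < 1, with probability at least 1 − δ, the following holds simultaneously for all integers j ≥ 0 and all cells A ∈ 𝒜_j: P̂(A) ≤ 2·max(P(A), 8·log(2^{j(d+1)}·16/δ)/n). -/

import Mathlib

open MeasureTheory Filter

noncomputable section

abbrev Pt (d : ℕ) := EuclideanSpace ℝ (Fin d)

/-- The unit cube `[0,1]^d`. -/
def cube (d : ℕ) : Set (Pt d) := {x | ∀ i, 0 ≤ x i ∧ x i ≤ 1}

/-- The closed `ε`-ball around `x`, relative to the cube `[0,1]^d`. -/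
def ballC (d : ℕ) (x : Pt d) (ε : ℝ) : Set (Pt d) := {y ∈ cube d | dist y x ≤ ε}

/-- The inner `ε`-cover of `G`: the union of all `ε`-balls contained in `G`. -/
def innerCover (d : ℕ) (ε : ℝ) (G : Set (Pt d)) : Set (Pt d) :=
  ⋃ x ∈ {x : Pt d | ballC d x ε ⊆ G}, ballC d x ε

open Classical in
/-- The Hausdorff error `d_∞(G₁, G₂)`, defined as `√d` if either set is empty. -/
def hausd (d : ℕ) (G₁ G₂ : Set (Pt d)) : ℝ :=
  if G₁.Nonempty ∧ G₂.Nonempty then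
    max (⨆ x ∈ G₂, Metric.infDist x G₁) (⨆ x ∈ G₁, Metric.infDist x G₂)
  else Real.sqrt d

/-- Indices for the cells of the regular partition of `[0,1]^d` at resolution `j`. -/
abbrev CellIdx (d j : ℕ) := Fin d → Fin (2 ^ j)

/-- The dyadic hypercube cell of sidelength `2⁻ʲ` indexed by `k` (cells on the
upper boundary of the cube are closed on the right, so that the cells partition
`[0,1]^d`). -/
def cell (d j : ℕ) (k : CellIdx d j) : Set (Pt d) :=
  {x | ∀ i, ((k i : ℕ) : ℝ) / 2 ^ j ≤ x i ∧
    (x i < (((k i : ℕ) : ℝ) + 1) / 2 ^ j ∨ ((k i : ℕ) + 1 = 2 ^ j ∧ x i ≤ 1))}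

/-- Empirical probability of a set `A`. -/
def Phat {d n : ℕ} (ω : Fin n → Pt d) (A : Set (Pt d)) : ℝ :=
  (∑ i, A.indicator (fun _ => (1 : ℝ)) (ω i)) / n

/-- Empirical average density `f̂(A) = P̂(A)/μ(A)` of the cell indexed by `k`. -/
def fhat {d n : ℕ} (j : ℕ) (ω : Fin n → Pt d) (k : CellIdx d j) : ℝ :=
  Phat ω (cell d j k) * 2 ^ (j * d)

/-- True average density `f̄(A) = P(A)/μ(A)` of the cell indexed by `k`. -/
def fbar {d : ℕ} (P : Measure (Pt d)) (j : ℕ) (k : CellIdx d j) : ℝ :=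
  (P (cell d j k)).toReal * 2 ^ (j * d)

/-- The plug-in level set estimator at resolution `j`. -/
def Ghat (d n j : ℕ) (γ : ℝ) (ω : Fin n → Pt d) : Set (Pt d) :=
  ⋃ k ∈ {k : CellIdx d j | γ ≤ fhat j ω k}, cell d j k

/-- The `γ`-level set of `f` on `[0,1]^d`. -/
def Gstar (d : ℕ) (f : Pt d → ℝ) (γ : ℝ) : Set (Pt d) := {x ∈ cube d | γ ≤ f x}

/-- The penalty `Ψ_j` at resolution `j` with confidence parameter `δ`. -/
def pen (d n j : ℕ) (δ : ℝ) (ω : Fin n → Pt d) : ℝ :=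
  ⨆ k : CellIdx d j,
    Real.sqrt (8 * (Real.log ((2 : ℝ) ^ (j * (d + 1)) * 16 / δ) / ((n : ℝ) / 2 ^ (j * d))) *
      max (fhat j ω k)
        (8 * (Real.log ((2 : ℝ) ^ (j * (d + 1)) * 16 / δ) / ((n : ℝ) / 2 ^ (j * d)))))

/-- `j' = ⌊j + log₂ s⌋`. -/
def jprime (j : ℕ) (s : ℝ) : ℕ := (⌊(j : ℝ) + Real.logb 2 s⌋).toNat

/-- Generic vernier: min over cells at resolution `j` of the max over subcells at
resolution `j'` of `|γ - g(A')|`. -/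
def vernier (d : ℕ) (γ : ℝ) (j j' : ℕ) (g : CellIdx d j' → ℝ) : ℝ :=
  ⨅ k : CellIdx d j, ⨆ k' : {k' : CellIdx d j' // cell d j' k' ⊆ cell d j k}, |γ - g k'.1|

/-- The vernier `V_{γ,j}`. -/
def V (d : ℕ) (P : Measure (Pt d)) (γ : ℝ) (j j' : ℕ) : ℝ := vernier d γ j j' (fbar P j')

/-- The empirical vernier `V̂_{γ,j}`. -/
def Vhat (d n : ℕ) (ω : Fin n → Pt d) (γ : ℝ) (j j' : ℕ) : ℝ := vernier d γ j j' (fhat j' ω)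

/-- The joint distribution of `n` i.i.d. observations from `P`. -/
def Pn {d : ℕ} (P : Measure (Pt d)) (n : ℕ) : Measure (Fin n → Pt d) :=
  Measure.pi fun _ => P

/-- `f` is a probability density (w.r.t. Lebesgue measure) supported on the unit cube,
and `P` is the corresponding probability measure. -/
def IsDensity (d : ℕ) (f : Pt d → ℝ) (P : Measure (Pt d)) : Prop :=
  Measurable f ∧ (∀ x, 0 ≤ f x) ∧ (∀ x, x ∉ cube d → f x = 0) ∧
  P = volume.withDensity (fun x => ENNReal.ofReal (f x)) ∧ IsProbabilityMeasure P

/-- The density `f` is bounded by `fmax`. -/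
def BoundedBy (d : ℕ) (f : Pt d → ℝ) (fmax : ℝ) : Prop := ∀ x, f x ≤ fmax

/-- Assumption [A1]: local density regularity (lower bound). -/
def A1 (d : ℕ) (f : Pt d → ℝ) (γ C₁ δ₁ α : ℝ) : Prop :=
  ∀ x ∈ cube d, |f x - γ| ≤ δ₁ →
    C₁ * Metric.infDist x (frontier (Gstar d f γ)) ^ α ≤ |f x - γ|

/-- Assumption [A2]: local density regularity (upper bound near some boundary point). -/
def A2 (d : ℕ) (f : Pt d → ℝ) (γ C₂ δ₂ α : ℝ) : Prop :=
  ∃ x₀ ∈ frontier (Gstar d f γ), ∀ x ∈ ballC d x₀ δ₂,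
    |f x - γ| ≤ C₂ * Metric.infDist x (frontier (Gstar d f γ)) ^ α

/-- Assumption [B]: level set regularity. -/
def AB (d : ℕ) (G : Set (Pt d)) (C₃ ε₀ : ℝ) : Prop :=
  ∀ ε : ℝ, 0 < ε → ε ≤ ε₀ →
    (innerCover d ε G).Nonempty ∧
    ∀ x ∈ frontier G, Metric.infDist x (innerCover d ε G) ≤ C₃ * ε


theorem measurableSet_cell (d j : ℕ) (k : CellIdx d j) : MeasurableSet (cell d j k) := by
  unfold cell
  rw [Set.ofPred_forall]
  refine MeasurableSet.iInter fun i => ?_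
  have hm : Measurable fun x : Pt d => x i := by fun_prop
  refine (measurableSet_le measurable_const hm).inter
    ((measurableSet_lt hm measurable_const).union ?_)
  exact (MeasurableSet.const _).inter (measurableSet_le hm measurable_const)

/-- Chernoff bound for the number of hits of `A` among `n` independent draws from `P`. -/
theorem measure_le_sum_indicator_le {α : Type*} [MeasurableSpace α] (P : Measure α)
    [IsProbabilityMeasure P] (n : ℕ) {A : Set α} (hA : MeasurableSet A) (x : ℝ) :
    (Measure.pi fun _ : Fin n => P) {ω | x ≤ ∑ i, A.indicator (fun _ => (1 : ℝ)) (ω i)} ≤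
      ENNReal.ofReal (Real.exp (n * P.real A - x * Real.log 2)) := by
  set μ := Measure.pi fun _ : Fin n => P
  let g : α → ℝ := fun a => 1 + A.indicator (fun _ => (1 : ℝ)) a
  have hg0 : ∀ a, 0 ≤ g a := fun a =>
    add_nonneg zero_le_one (Set.indicator_nonneg (fun _ _ => zero_le_one) a)
  have hg : ∀ a, g a = Real.exp (Real.log 2 * A.indicator (fun _ => (1 : ℝ)) a) := by
    intro a
    by_cases h : a ∈ A
    · simp only [g, Set.indicator_of_mem h, mul_one, Real.exp_log two_pos]; norm_num
    · simp [g, h]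
  have hind : Integrable (A.indicator (fun _ => (1 : ℝ))) P :=
    (integrable_const 1).indicator hA
  have hgi : Integrable g P := (integrable_const 1).add hind
  have hint : Integrable (fun ω : Fin n → α => ∏ i, g (ω i)) μ :=
    Integrable.fintype_prod fun _ => hgi
  have hval : ∫ ω, ∏ i, g (ω i) ∂μ = (1 + P.real A) ^ n := by
    rw [integral_fintype_prod_eq_pow (ι := Fin n) (μ := P) g, Fintype.card_fin,
      integral_add (integrable_const 1) hind, integral_indicator_const _ hA]
    simp
  have hprod : ∀ ω : Fin n → α, ∏ i, g (ω i) =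
      Real.exp (Real.log 2 * ∑ i, A.indicator (fun _ => (1 : ℝ)) (ω i)) := by
    intro ω
    rw [Finset.mul_sum, Real.exp_sum]
    exact Finset.prod_congr rfl fun i _ => hg _
  have hmarkov := mul_meas_ge_le_integral_of_nonneg
    (Filter.Eventually.of_forall fun ω => Finset.prod_nonneg fun i _ => hg0 (ω i))
    hint (Real.exp (Real.log 2 * x))
  rw [hval] at hmarkov
  have hset : {ω : Fin n → α | Real.exp (Real.log 2 * x) ≤ ∏ i, g (ω i)} =
      {ω | x ≤ ∑ i, A.indicator (fun _ => (1 : ℝ)) (ω i)} := by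
    ext ω
    simp only [Set.mem_ofPred_eq, hprod, Real.exp_le_exp,
      mul_le_mul_iff_right₀ (Real.log_pos one_lt_two)]
  rw [hset] at hmarkov
  have hpow : (1 + P.real A) ^ n ≤ Real.exp (n * P.real A) := by
    rw [Real.exp_nat_mul]
    gcongr
    linarith [Real.add_one_le_exp (P.real A)]
  rw [← ofReal_measureReal]
  apply ENNReal.ofReal_le_ofReal
  rw [Real.exp_sub, le_div_iff₀ (Real.exp_pos _), mul_comm, mul_comm x]
  exact hmarkov.trans hpow

/-- The relative deviation `P̂(A) > 2 max(P(A), 8L/n)` has probability at most `e^{-L}`. -/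
theorem measure_lt_Phat_le {d n : ℕ} (hn : 1 ≤ n) (P : Measure (Pt d)) [IsProbabilityMeasure P]
    {A : Set (Pt d)} (hA : MeasurableSet A) {L : ℝ} (hL : 0 ≤ L) :
    Pn P n {ω | 2 * max (P A).toReal (8 * L / n) < Phat ω A} ≤
      ENNReal.ofReal (Real.exp (-L)) := by
  have hn0 : (0 : ℝ) < n := by exact_mod_cast hn
  set T := max (P A).toReal (8 * L / n)
  refine (measure_mono ?_).trans ((measure_le_sum_indicator_le P n hA (2 * T * n)).trans ?_)
  · intro ω hω
    exact ((lt_div_iff₀ hn0).1 hω).le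
  · refine ENNReal.ofReal_le_ofReal (Real.exp_le_exp.2 ?_)
    have h1 : P.real A * n ≤ T * n := mul_le_mul_of_nonneg_right (le_max_left _ _) hn0.le
    have h2 : 8 * L ≤ T * n := (div_le_iff₀ hn0).1 (le_max_right _ _)
    nlinarith [Real.log_two_gt_d9]

/-- Relative VC bound: with probability at least `1 - δ`, simultaneously for all `j ≥ 0`
and all cells `A ∈ 𝒜_j`, `P̂(A) ≤ 2 max(P(A), 8 log(2^{j(d+1)}·16/δ)/n)`. -/
theorem statement7 (d n : ℕ) (hd : 1 ≤ d) (hn : 1 ≤ n)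
    (f : Pt d → ℝ) (P : Measure (Pt d)) (fmax : ℝ) (hfmax : 0 < fmax)
    (hf : IsDensity d f P) (hb : BoundedBy d f fmax)
    (δ : ℝ) (hδ0 : 0 < δ) (hδ1 : δ < 1) :
    ENNReal.ofReal (1 - δ) ≤ Pn P n {ω | ∀ j : ℕ, ∀ k : CellIdx d j,
      Phat ω (cell d j k) ≤
        2 * max (P (cell d j k)).toReal
          (8 * Real.log ((2 : ℝ) ^ (j * (d + 1)) * 16 / δ) / n)} := by
  have : IsProbabilityMeasure P := hf.2.2.2.2
  have : IsProbabilityMeasure (Pn P n) := by unfold Pn; infer_instance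
  set G := {ω : Fin n → Pt d | ∀ j : ℕ, ∀ k : CellIdx d j,
      Phat ω (cell d j k) ≤
        2 * max (P (cell d j k)).toReal
          (8 * Real.log ((2 : ℝ) ^ (j * (d + 1)) * 16 / δ) / n)} with hG
  have hcell : ∀ (j : ℕ) (k : CellIdx d j),
      Pn P n {ω | 2 * max (P (cell d j k)).toReal
        (8 * Real.log ((2 : ℝ) ^ (j * (d + 1)) * 16 / δ) / n) < Phat ω (cell d j k)} ≤
      ENNReal.ofReal (δ / (2 ^ (j * (d + 1)) * 16)) := by
    intro j k
    have h2 : (1 : ℝ) ≤ 2 ^ (j * (d + 1)) := one_le_pow₀ one_le_two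
    have hL : 0 ≤ Real.log ((2 : ℝ) ^ (j * (d + 1)) * 16 / δ) := by
      apply Real.log_nonneg
      rw [le_div_iff₀ hδ0]
      linarith
    refine (measure_lt_Phat_le hn P (measurableSet_cell d j k) hL).trans_eq ?_
    rw [Real.exp_neg, Real.exp_log (by positivity), inv_div]
  have hbad : Pn P n Gᶜ ≤ ENNReal.ofReal δ := by
    have hsub : Gᶜ ⊆ ⋃ j : ℕ, ⋃ k : CellIdx d j, {ω | 2 * max (P (cell d j k)).toReal
        (8 * Real.log ((2 : ℝ) ^ (j * (d + 1)) * 16 / δ) / n) < Phat ω (cell d j k)} := by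
      intro ω hω
      simpa [hG] using hω
    calc Pn P n Gᶜ ≤ ∑' j : ℕ, ∑ _k : CellIdx d j,
          ENNReal.ofReal (δ / (2 ^ (j * (d + 1)) * 16)) := by
            refine (measure_mono hsub).trans ((measure_iUnion_le _).trans ?_)
            refine ENNReal.tsum_le_tsum fun j => ?_
            exact (measure_iUnion_fintype_le _ _).trans (Finset.sum_le_sum fun k _ => hcell j k)
      _ = ∑' j : ℕ, ENNReal.ofReal (δ / 16 * (1 / 2) ^ j) := by
            refine tsum_congr fun j => ?_
            rw [Finset.sum_const, nsmul_eq_mul, ← ENNReal.ofReal_natCast,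
              ← ENNReal.ofReal_mul (Nat.cast_nonneg _)]
            congr 1
            simp only [Finset.card_univ, Fintype.card_fun, Fintype.card_fin]
            push_cast
            rw [mul_add, pow_add, mul_one, ← pow_mul, one_div, inv_pow]
            field_simp
      _ = ENNReal.ofReal (δ / 16 * 2) := by
            rw [← ENNReal.ofReal_tsum_of_nonneg (fun j => by positivity)
              (summable_geometric_two.mul_left _), tsum_mul_left, tsum_geometric_two]
      _ ≤ ENNReal.ofReal δ := ENNReal.ofReal_le_ofReal (by linarith)
  rw [ENNReal.ofReal_sub _ hδ0.le, ENNReal.ofReal_one, tsub_le_iff_right]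
  calc (1 : ENNReal) = Pn P n (G ∪ Gᶜ) := by simp
    _ ≤ Pn P n G + Pn P n Gᶜ := measure_union_le _ _
    _ ≤ Pn P n G + ENNReal.ofReal δ := by gcongr

end
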